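/- arXiv:2210.05509 — 5 statements merged into one kernel-verified Lean document; each statement's English description precedes it below -/
import Mathlib

section
/- Let n ≥ 1 and let A be an invertible n×n real matrix with singular value decomposition A = U Σ Vᵀ, where U and V are orthogonal and Σ = diag(σ₁, …, σₙ) with σ₁ ≥ … ≥ σₙ > 0. Then the matrix X* = U · diag(1, 1, …, 1, det(U Vᵀ)) · Vᵀ lies in the special orthogonal group SO(n) and minimizes the Frobenius norm ‖X − A‖_F over all X ∈ SO(n); that is, for every X ∈ SO(n), ‖X* − A‖_F ≤ ‖X − A‖_F. -/
open Matrix BigOperators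

/-- Frobenius norm of a real square matrix. -/
noncomputable def frobNorm {n : ℕ} (M : Matrix (Fin n) (Fin n) ℝ) : ℝ :=
  Real.sqrt (∑ i, ∑ j, (M i j) ^ 2)

/-- Membership in the orthogonal group `O(n)`. -/
def IsOrth {n : ℕ} (X : Matrix (Fin n) (Fin n) ℝ) : Prop :=
  Xᵀ * X = 1 ∧ X * Xᵀ = 1

/-- Membership in the special orthogonal group `SO(n)`. -/
def IsSO {n : ℕ} (X : Matrix (Fin n) (Fin n) ℝ) : Prop :=
  Xᵀ * X = 1 ∧ X * Xᵀ = 1 ∧ X.det = 1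

theorem frob_sq_trace {n : ℕ} (M : Matrix (Fin n) (Fin n) ℝ) :
    ∑ i, ∑ j, (M i j) ^ 2 = (Mᵀ * M).trace := by
  rw [Finset.sum_comm]
  simp [Matrix.trace, Matrix.mul_apply, pow_two]

theorem orth_diag_le {n : ℕ} {W : Matrix (Fin n) (Fin n) ℝ} (hW : Wᵀ * W = 1) (i : Fin n) :
    W i i ≤ 1 := by
  have h := congrFun (congrFun hW i) i
  simp only [Matrix.mul_apply, Matrix.transpose_apply, Matrix.one_apply_eq] at h
  have h2 : W i i * W i i ≤ ∑ j, W j i * W j i :=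
    Finset.single_le_sum (f := fun j => W j i * W j i) (fun j _ => mul_self_nonneg _)
      (Finset.mem_univ i)
  nlinarith

theorem orth_trace_le {n : ℕ} {W : Matrix (Fin n) (Fin n) ℝ} (hW : Wᵀ * W = 1)
    (hd : W.det = -1) : W.trace ≤ n - 2 := by
  have h0 : (1 + W).det = 0 := by
    have hW' : W * Wᵀ = 1 := mul_eq_one_comm.mp hW
    have h1 : 1 + W = W * (1 + W)ᵀ := by
      rw [Matrix.transpose_add, Matrix.transpose_one, Matrix.mul_add, hW', Matrix.mul_one, add_comm]
    have h2 := congrArg Matrix.det h1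
    rw [Matrix.det_mul, Matrix.det_transpose, hd] at h2
    linarith
  obtain ⟨v, hv, hv0⟩ := Matrix.exists_mulVec_eq_zero_iff.mpr h0
  have hWv : (1 - W) *ᵥ v = (2 : ℝ) • v := by
    rw [Matrix.add_mulVec, Matrix.one_mulVec] at hv0
    rw [Matrix.sub_mulVec, Matrix.one_mulVec, eq_neg_of_add_eq_zero_right hv0]
    ext i
    simp
    ring
  have hpos : 0 < ∑ j, v j ^ 2 := by
    obtain ⟨j, hj⟩ := Function.ne_iff.mp hv
    have hj' : v j ≠ 0 := hj
    exact Finset.sum_pos' (fun _ _ => sq_nonneg _) ⟨j, Finset.mem_univ _, by positivity⟩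
  have hcs : ∑ i, ((1 - W) *ᵥ v) i ^ 2 ≤ (∑ i, ∑ j, ((1 - W) i j) ^ 2) * ∑ j, v j ^ 2 := by
    rw [Finset.sum_mul]
    exact Finset.sum_le_sum fun i _ => Finset.sum_mul_sq_le_sq_mul_sq Finset.univ (fun j => (1 - W) i j) v
  have h4 : ∑ i, ((1 - W) *ᵥ v) i ^ 2 = 4 * ∑ j, v j ^ 2 := by
    rw [hWv, Finset.mul_sum]
    refine Finset.sum_congr rfl fun i _ => ?_
    simp
    ring
  rw [h4] at hcs
  have h5 := le_of_mul_le_mul_right hcs hpos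
  have h6 : (1 - W)ᵀ * (1 - W) = 1 - W - Wᵀ + 1 := by
    rw [Matrix.transpose_sub, Matrix.transpose_one, Matrix.sub_mul, Matrix.mul_sub, Matrix.mul_sub,
      hW]
    simp only [Matrix.one_mul, Matrix.mul_one]
    abel
  rw [frob_sq_trace, h6] at h5
  simp only [Matrix.trace_add, Matrix.trace_sub, Matrix.trace_transpose, Matrix.trace_one,
    Fintype.card_fin] at h5
  linarith

theorem frob_expand {n : ℕ} (X U V : Matrix (Fin n) (Fin n) ℝ) (σ : Fin n → ℝ)
    (hX : Xᵀ * X = 1) :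
    ∑ i, ∑ j, ((X - U * Matrix.diagonal σ * Vᵀ) i j) ^ 2 =
      n + ((U * Matrix.diagonal σ * Vᵀ)ᵀ * (U * Matrix.diagonal σ * Vᵀ)).trace
        - 2 * ∑ i, (Uᵀ * X * V) i i * σ i := by
  have h : ((U * Matrix.diagonal σ * Vᵀ)ᵀ * X).trace = ∑ i, (Uᵀ * X * V) i i * σ i := by
    have e : (U * Matrix.diagonal σ * Vᵀ)ᵀ * X = V * (Matrix.diagonal σ * (Uᵀ * X)) := by
      simp [Matrix.transpose_mul, Matrix.mul_assoc]
    rw [e, Matrix.trace_mul_comm, Matrix.mul_assoc, Matrix.trace_mul_comm]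
    simp [Matrix.trace, Matrix.mul_diagonal]
  rw [frob_sq_trace]
  generalize U * Matrix.diagonal σ * Vᵀ = A at *
  have h' : (Xᵀ * A).trace = (Aᵀ * X).trace := by
    rw [← Matrix.trace_transpose, Matrix.transpose_mul, Matrix.transpose_transpose]
  rw [Matrix.transpose_sub, Matrix.sub_mul, Matrix.mul_sub, Matrix.mul_sub, hX]
  simp only [Matrix.trace_sub, Matrix.trace_one, Fintype.card_fin, h', h]
  ring

/-- For an invertible `A` with SVD `A = U Σ Vᵀ` (singular values `σ₁ ≥ ⋯ ≥ σₙ > 0`),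
the matrix `X* = U diag(1,…,1, det(UVᵀ)) Vᵀ` lies in `SO(n)` and minimizes the Frobenius
distance to `A` over `SO(n)`. -/
theorem frechet_projection_onto_SO (n : ℕ) (hn : 1 ≤ n)
    (A U V : Matrix (Fin n) (Fin n) ℝ) (σ : Fin n → ℝ)
    (hA : IsUnit A) (hU : IsOrth U) (hV : IsOrth V)
    (hσdec : Antitone σ) (hσpos : ∀ i, 0 < σ i)
    (hSVD : A = U * Matrix.diagonal σ * Vᵀ) :
    IsSO (U * Matrix.diagonal (fun i : Fin n => if (i : ℕ) = n - 1 then (U * Vᵀ).det else 1) * Vᵀ) ∧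
    ∀ X : Matrix (Fin n) (Fin n) ℝ, IsSO X →
      frobNorm (U * Matrix.diagonal (fun i : Fin n => if (i : ℕ) = n - 1 then (U * Vᵀ).det else 1) * Vᵀ - A)
        ≤ frobNorm (X - A) := by
  obtain ⟨hU1, hU2⟩ := hU
  obtain ⟨hV1, hV2⟩ := hV
  set d := (U * Vᵀ).det with hd
  have hdd : d * d = 1 := by
    have h : (U * Vᵀ) * (U * Vᵀ)ᵀ = 1 := by
      rw [Matrix.transpose_mul, Matrix.transpose_transpose, Matrix.mul_assoc,
        ← Matrix.mul_assoc Vᵀ, hV1, Matrix.one_mul, hU2]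
    have h2 := congrArg Matrix.det h
    rwa [Matrix.det_mul, Matrix.det_transpose, Matrix.det_one] at h2
  set f : Fin n → ℝ := fun i => if (i : ℕ) = n - 1 then d else 1 with hf
  let l : Fin n := ⟨n - 1, by omega⟩
  have hfl : ∀ i, f i = if i = l then d else 1 := by
    intro i
    simp [hf, l, Fin.ext_iff]
  have hff : Matrix.diagonal f * Matrix.diagonal f = 1 := by
    rw [Matrix.diagonal_mul_diagonal, ← Matrix.diagonal_one]
    congr 1
    ext i
    rw [hfl]
    split_ifs <;> simp [hdd]
  have hS1 : (U * Matrix.diagonal f * Vᵀ)ᵀ * (U * Matrix.diagonal f * Vᵀ) = 1 := by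
    calc _ = V * (Matrix.diagonal f * (Uᵀ * U) * Matrix.diagonal f) * Vᵀ := by
          simp [Matrix.transpose_mul, Matrix.mul_assoc]
      _ = 1 := by rw [hU1, Matrix.mul_one, hff, Matrix.mul_one, hV2]
  have hprod : ∏ i, f i = d := by
    simp [hfl]
  refine ⟨⟨hS1, mul_eq_one_comm.mp hS1, ?_⟩, ?_⟩
  · rw [Matrix.det_mul, Matrix.det_mul, Matrix.det_diagonal, hprod]
    rw [Matrix.det_mul] at hd
    calc _ = d * (U.det * Vᵀ.det) := by ring
      _ = 1 := by rw [← hd, hdd]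
  · rintro X ⟨hX1, hX2, hX3⟩
    unfold frobNorm
    apply Real.sqrt_le_sqrt
    rw [hSVD, frob_expand _ U V σ hS1, frob_expand _ U V σ hX1]
    have hD : Uᵀ * (U * Matrix.diagonal f * Vᵀ) * V = Matrix.diagonal f := by
      calc _ = (Uᵀ * U) * Matrix.diagonal f * (Vᵀ * V) := by simp only [Matrix.mul_assoc]
        _ = _ := by rw [hU1, hV1, Matrix.one_mul, Matrix.mul_one]
    rw [hD]
    have hW : (Uᵀ * X * V)ᵀ * (Uᵀ * X * V) = 1 := by
      calc _ = Vᵀ * (Xᵀ * (U * Uᵀ) * X) * V := by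
            simp [Matrix.transpose_mul, Matrix.mul_assoc]
        _ = 1 := by rw [hU2, Matrix.mul_one, hX1, Matrix.mul_one, hV1]
    have hWd : (Uᵀ * X * V).det = d := by
      rw [hd, Matrix.det_mul, Matrix.det_mul, Matrix.det_mul, hX3, Matrix.det_transpose,
        Matrix.det_transpose, mul_one]
    generalize Uᵀ * X * V = W at hW hWd
    have key : ∑ i, W i i * σ i ≤ ∑ i, f i * σ i := by
      rcases mul_self_eq_one_iff.mp hdd with h | h
      · refine Finset.sum_le_sum fun i _ => ?_
        have : f i = 1 := by rw [hfl, h]; simp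
        rw [this]
        exact mul_le_mul_of_nonneg_right (orth_diag_le hW i) (hσpos i).le
      · have ht := orth_trace_le hW (hWd.trans h)
        have hs : ∑ i, f i * σ i = ∑ i, σ i - 2 * σ l := by
          have : ∀ i, f i * σ i = σ i - if i = l then 2 * σ l else 0 := by
            intro i
            rw [hfl, h]
            split_ifs with hi
            · rw [hi]; ring
            · ring
          simp only [this, Finset.sum_sub_distrib, Finset.sum_ite_eq', Finset.mem_univ, if_true]
        have h1 : ∑ i, (1 - W i i) * σ l ≤ ∑ i, (1 - W i i) * σ i := by
          refine Finset.sum_le_sum fun i _ => ?_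
          refine mul_le_mul_of_nonneg_left (hσdec ?_) (sub_nonneg.mpr (orth_diag_le hW i))
          rw [Fin.le_def]
          have := i.2
          simp only [l]
          omega
        rw [← Finset.sum_mul, Finset.sum_sub_distrib] at h1
        simp only [sub_mul, one_mul, Finset.sum_sub_distrib, Finset.sum_const, Finset.card_univ,
          Fintype.card_fin, nsmul_eq_mul, mul_one] at h1
        have h2 : ∑ i, W i i = W.trace := rfl
        rw [h2] at h1
        rw [hs]
        nlinarith [hσpos l]
    simp only [Matrix.diagonal_apply_eq]
    linarith
end

section
/- Let n ≥ 1, let X' ∈ SO(n), and let Σ₀ = diag(σ₁, …, σ_{n−1}, −σₙ) be the n×n diagonal matrix with diagonal entries σ₁, …, σ_{n−1}, −σₙ, where σ₁ > σ₂ > … > σ_{n−1} > σₙ > 0. If the matrix Y = (X')ᵀ Σ₀ is symmetric, then X' is a diagonal matrix. -/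
open Matrix BigOperators

/-- Let `X' ∈ SO(n)` and `Σ₀ = diag(σ₁, …, σ_{n−1}, −σₙ)` with
`σ₁ > ⋯ > σ_{n−1} > σₙ > 0`. If `Y = (X')ᵀ Σ₀` is symmetric, then `X'` is diagonal. -/
theorem diagonal_of_symm_mul_signedDiagonal (n : ℕ) (hn : 1 ≤ n)
    (X' : Matrix (Fin n) (Fin n) ℝ) (σ : Fin n → ℝ)
    (hX' : IsSO X')
    (hσdec : StrictAnti σ) (hσpos : ∀ i, 0 < σ i)
    (hY : (X'ᵀ * Matrix.diagonal
      (fun i : Fin n => if (i : ℕ) = n - 1 then -σ i else σ i)).IsSymm) :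
    X'.IsDiag := by
  obtain ⟨_, h2, _⟩ := hX'
  set d : Fin n → ℝ := fun i : Fin n => if (i : ℕ) = n - 1 then -σ i else σ i with hd
  have hs : Matrix.diagonal d * X' = X'ᵀ * Matrix.diagonal d := by
    have h := hY.eq
    rwa [Matrix.transpose_mul, Matrix.diagonal_transpose, Matrix.transpose_transpose] at h
  -- `D²` commutes with `X'`
  have hc : X' * (Matrix.diagonal d * Matrix.diagonal d)
      = (Matrix.diagonal d * Matrix.diagonal d) * X' := by
    calc X' * (Matrix.diagonal d * Matrix.diagonal d)
        = X' * (Matrix.diagonal d * (X' * X'ᵀ) * Matrix.diagonal d) := by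
          rw [h2, Matrix.mul_one]
      _ = X' * ((Matrix.diagonal d * X') * (X'ᵀ * Matrix.diagonal d)) := by
          simp only [Matrix.mul_assoc]
      _ = X' * ((X'ᵀ * Matrix.diagonal d) * (Matrix.diagonal d * X')) := by
          rw [hs]
      _ = (X' * X'ᵀ) * ((Matrix.diagonal d * Matrix.diagonal d) * X') := by
          simp only [Matrix.mul_assoc]
      _ = _ := by rw [h2, Matrix.one_mul]
  have hsq : ∀ i, d i * d i = σ i * σ i := by
    intro i
    simp only [hd]
    split_ifs <;> ring
  intro i j hij
  have he := congrFun (congrFun hc i) j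
  rw [Matrix.diagonal_mul_diagonal, Matrix.mul_diagonal, Matrix.diagonal_mul, hsq, hsq] at he
  have hne : σ j - σ i ≠ 0 := fun h => hij (hσdec.injective (sub_eq_zero.mp h)).symm
  have hpos : σ j + σ i ≠ 0 := (add_pos (hσpos j) (hσpos i)).ne'
  have hz : ((σ j - σ i) * (σ j + σ i)) * X' i j = 0 := by linarith
  exact (mul_eq_zero.mp hz).resolve_left (mul_ne_zero hne hpos)
end

section
/- Let n ≥ 1 and let A be an n×n real matrix with singular value decomposition A = U Σ Vᵀ (U, V orthogonal, Σ diagonal with nonnegative decreasing diagonal). Then U Vᵀ minimizes the Frobenius norm ‖X − A‖_F over all X in the orthogonal group O(n); that is, for every X ∈ O(n), ‖U Vᵀ − A‖_F ≤ ‖X − A‖_F. -/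
open Matrix BigOperators

theorem frob_inv_aux {n : ℕ} (U V M : Matrix (Fin n) (Fin n) ℝ) (hU : IsOrth U) (hV : IsOrth V) :
    frobNorm (U * M * Vᵀ) = frobNorm M := by
  have key : ∀ N : Matrix (Fin n) (Fin n) ℝ, ∑ i, ∑ j, (N i j) ^ 2 = (Nᵀ * N).trace := by
    intro N
    rw [Finset.sum_comm]
    simp [Matrix.trace, Matrix.mul_apply, pow_two]
  unfold frobNorm
  rw [key, key]
  congr 1
  have h1 : (U * M * Vᵀ)ᵀ * (U * M * Vᵀ) = V * (Mᵀ * (Uᵀ * U) * M * Vᵀ) := by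
    simp only [Matrix.transpose_mul, Matrix.transpose_transpose, Matrix.mul_assoc]
  rw [h1, hU.1, Matrix.trace_mul_comm, Matrix.mul_assoc _ Vᵀ V, hV.1, Matrix.mul_one,
    Matrix.mul_one]

theorem frob_diag_aux {n : ℕ} (Z : Matrix (Fin n) (Fin n) ℝ) (hZ : Z * Zᵀ = 1) (σ : Fin n → ℝ)
    (hσ : ∀ i, 0 ≤ σ i) :
    frobNorm (1 - Matrix.diagonal σ) ≤ frobNorm (Z - Matrix.diagonal σ) := by
  unfold frobNorm
  apply Real.sqrt_le_sqrt
  have row : ∀ W : Matrix (Fin n) (Fin n) ℝ, W * Wᵀ = 1 → ∀ i,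
      ∑ j, ((W - Matrix.diagonal σ) i j) ^ 2 = 1 - 2 * σ i * W i i + σ i ^ 2 := by
    intro W hW i
    have h := congrFun (congrFun hW i) i
    simp only [Matrix.mul_apply, Matrix.transpose_apply, Matrix.one_apply_eq] at h
    have e : ∀ j, ((W - Matrix.diagonal σ) i j) ^ 2
        = W i j * W i j + (if i = j then σ i ^ 2 - 2 * σ i * W i i else 0) := by
      intro j
      by_cases hij : i = j
      · subst hij
        simp
        ring
      · simp [hij]
        ring
    simp only [e, Finset.sum_add_distrib, h, Finset.sum_ite_eq, Finset.mem_univ, if_true]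
    ring
  apply Finset.sum_le_sum
  intro i _
  rw [row 1 (by simp) i, row Z hZ i]
  have h := congrFun (congrFun hZ i) i
  simp only [Matrix.mul_apply, Matrix.transpose_apply, Matrix.one_apply_eq] at h
  have h2 : Z i i * Z i i ≤ 1 := by
    rw [← h]
    exact Finset.single_le_sum (f := fun j => Z i j * Z i j)
      (fun j _ => mul_self_nonneg _) (Finset.mem_univ i)
  have h3 : Z i i ≤ 1 := by nlinarith
  have h4 := mul_le_mul_of_nonneg_left h3 (hσ i)
  simp only [Matrix.one_apply_eq]
  linarith

/-- If `A = U Σ Vᵀ` is an SVD of `A` (with `Σ` diagonal, nonnegative decreasing),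
then `U Vᵀ` minimizes the Frobenius distance to `A` over the orthogonal group `O(n)`. -/
theorem orthogonal_procrustes (n : ℕ) (hn : 1 ≤ n)
    (A U V : Matrix (Fin n) (Fin n) ℝ) (σ : Fin n → ℝ)
    (hU : IsOrth U) (hV : IsOrth V)
    (hσdec : Antitone σ) (hσnonneg : ∀ i, 0 ≤ σ i)
    (hSVD : A = U * Matrix.diagonal σ * Vᵀ) :
    ∀ X : Matrix (Fin n) (Fin n) ℝ, IsOrth X →
      frobNorm (U * Vᵀ - A) ≤ frobNorm (X - A) := by
  intro X hX
  have hZ : (Uᵀ * X * V) * (Uᵀ * X * V)ᵀ = 1 := by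
    have h1 : (Uᵀ * X * V) * (Uᵀ * X * V)ᵀ = Uᵀ * (X * (V * Vᵀ) * Xᵀ) * U := by
      simp only [Matrix.transpose_mul, Matrix.transpose_transpose, Matrix.mul_assoc]
    rw [h1, hV.2, Matrix.mul_one, hX.2, Matrix.mul_one, hU.1]
  have e1 : U * Vᵀ - A = U * (1 - Matrix.diagonal σ) * Vᵀ := by
    rw [hSVD, Matrix.mul_sub, Matrix.sub_mul, Matrix.mul_one]
  have e2 : X - A = U * (Uᵀ * X * V - Matrix.diagonal σ) * Vᵀ := by
    have h1 : U * (Uᵀ * X * V) * Vᵀ = (U * Uᵀ) * X * (V * Vᵀ) := by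
      simp only [Matrix.mul_assoc]
    rw [Matrix.mul_sub, Matrix.sub_mul, h1, hU.2, hV.2, Matrix.one_mul, Matrix.mul_one, hSVD]
  rw [e1, e2, frob_inv_aux _ _ _ hU hV, frob_inv_aux _ _ _ hU hV]
  exact frob_diag_aux _ hZ σ hσnonneg
end

section
/- Let n ≥ 1, let σ₁ ≥ σ₂ ≥ … ≥ σₙ > 0 be real numbers, and let ε₁, …, εₙ ∈ {+1, −1} be signs with ∏ᵢ εᵢ = −1. Then ∑ᵢ₌₁ⁿ (1 − εᵢ σᵢ)² ≥ ∑ᵢ₌₁^{n−1} (1 − σᵢ)² + (1 + σₙ)²; i.e., among all sign patterns with an odd number of negative signs, the sum ∑ᵢ (1 − εᵢσᵢ)² is minimized by taking εᵢ = +1 for i ≤ n−1 and εₙ = −1. -/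
open BigOperators Finset

/-- Let `σ₁ ≥ ⋯ ≥ σₙ > 0` and let `ε₁, …, εₙ ∈ {+1, −1}` with `∏ᵢ εᵢ = −1`. Then
`∑ᵢ (1 − εᵢ σᵢ)² ≥ ∑_{i<n} (1 − σᵢ)² + (1 + σₙ)²`: among sign patterns with an odd
number of negative signs, the sum is minimized by flipping only the smallest `σ`. -/
theorem sum_sq_signs_ge (n : ℕ) (hn : 1 ≤ n) (σ ε : Fin n → ℝ)
    (hσdec : Antitone σ) (hσpos : ∀ i, 0 < σ i)
    (hε : ∀ i, ε i = 1 ∨ ε i = -1)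
    (hprod : ∏ i, ε i = -1) :
    (∑ i ∈ Finset.univ.filter (fun i : Fin n => (i : ℕ) < n - 1), (1 - σ i) ^ 2)
      + (1 + σ ⟨n - 1, by omega⟩) ^ 2
    ≤ ∑ i, (1 - ε i * σ i) ^ 2 := by
  obtain ⟨j, hj⟩ : ∃ j, ε j = -1 := by
    by_contra! h
    have h1 : ∀ i, ε i = 1 := fun i => (hε i).resolve_right (h i)
    simp only [h1, Finset.prod_const_one] at hprod
    norm_num at hprod
  set l : Fin n := ⟨n - 1, by omega⟩ with hl
  have hle : j ≤ l := by
    rw [Fin.le_def]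
    have := j.isLt
    simp only [hl]
    omega
  have hf : Finset.univ.filter (fun i : Fin n => (i : ℕ) < n - 1) = Finset.univ.erase l := by
    ext i
    have := i.isLt
    simp only [Finset.mem_filter, Finset.mem_univ, true_and, Finset.mem_erase, and_true, hl,
      ne_eq, Fin.ext_iff]
    omega
  have hs := Finset.sum_erase_add Finset.univ (fun i => (1 - σ i) ^ 2) (Finset.mem_univ l)
  have hr : ∑ i, (1 - ε i * σ i) ^ 2
      = ∑ i, (1 - σ i) ^ 2 + ∑ i, (2 - 2 * ε i) * σ i := by
    rw [← Finset.sum_add_distrib]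
    refine Finset.sum_congr rfl fun i _ => ?_
    rcases hε i with h | h <;> rw [h] <;> ring
  have hg : (2 - 2 * ε j) * σ j ≤ ∑ i, (2 - 2 * ε i) * σ i := by
    refine Finset.single_le_sum (f := fun i => (2 - 2 * ε i) * σ i) (fun i _ => ?_)
      (Finset.mem_univ j)
    have := hσpos i
    rcases hε i with h | h <;> simp only [h] <;> nlinarith
  rw [hj] at hg
  have hd := hσdec hle
  rw [hf, hr]
  nlinarith
end

section
/- Let n ≥ 1 and let A be an invertible n×n real matrix with det(A) < 0 and singular value decomposition A = U Σ Vᵀ (U, V orthogonal, Σ diagonal with positive decreasing diagonal σ₁ ≥ … ≥ σₙ). Then for X* = U · diag(1, …, 1, −1) · Vᵀ one has X* ∈ SO(n) and ‖X* − A‖_F² = ∑ᵢ₌₁^{n−1} (σᵢ − 1)² + (σₙ + 1)². -/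
open Matrix BigOperators

theorem frobNorm_sq_eq_trace {n : ℕ} (M : Matrix (Fin n) (Fin n) ℝ) :
    frobNorm M ^ 2 = (M * Mᵀ).trace := by
  unfold frobNorm
  have h : 0 ≤ ∑ i, ∑ j, (M i j) ^ 2 :=
    Finset.sum_nonneg fun i _ => Finset.sum_nonneg fun j _ => sq_nonneg _
  rw [Real.sq_sqrt h]
  simp [Matrix.trace, Matrix.mul_apply, sq]

theorem conj_mul_transpose {n : ℕ} {U V : Matrix (Fin n) (Fin n) ℝ} (hV : IsOrth V)
    (d : Fin n → ℝ) :
    (U * diagonal d * Vᵀ) * (U * diagonal d * Vᵀ)ᵀ = U * diagonal (fun i => d i * d i) * Uᵀ := by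
  rw [transpose_mul, transpose_mul, transpose_transpose, diagonal_transpose,
    ← diagonal_mul_diagonal]
  calc U * diagonal d * Vᵀ * (V * (diagonal d * Uᵀ))
      = U * diagonal d * (Vᵀ * V) * (diagonal d * Uᵀ) := by simp only [Matrix.mul_assoc]
    _ = _ := by rw [hV.1]; simp only [Matrix.mul_assoc, Matrix.one_mul]

theorem frobNorm_conj_sq {n : ℕ} {U V : Matrix (Fin n) (Fin n) ℝ} (hU : IsOrth U)
    (hV : IsOrth V) (d : Fin n → ℝ) :
    frobNorm (U * diagonal d * Vᵀ) ^ 2 = ∑ i, d i ^ 2 := by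
  rw [frobNorm_sq_eq_trace, conj_mul_transpose hV, Matrix.trace_mul_comm, ← Matrix.mul_assoc,
    hU.1, Matrix.one_mul, trace_diagonal]
  simp [sq]

theorem sum_split_last {n : ℕ} (hn : n - 1 < n) (f : Fin n → ℝ) :
    ∑ i, f i = (∑ i ∈ Finset.univ.filter (fun i : Fin n => (i : ℕ) < n - 1), f i)
      + f ⟨n - 1, hn⟩ := by
  rw [← Finset.sum_filter_add_sum_filter_not Finset.univ (fun i : Fin n => (i : ℕ) < n - 1)]
  congr 1
  have : Finset.univ.filter (fun i : Fin n => ¬ (i : ℕ) < n - 1) = {⟨n - 1, hn⟩} := by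
    ext i
    simp [Fin.ext_iff]
    omega
  rw [this, Finset.sum_singleton]

/-- For an invertible `A` with `det A < 0` and SVD `A = U Σ Vᵀ` (positive decreasing
singular values `σ₁ ≥ ⋯ ≥ σₙ`), the matrix `X* = U diag(1, …, 1, −1) Vᵀ` lies in `SO(n)`
and satisfies `‖X* − A‖_F² = ∑_{i<n} (σᵢ − 1)² + (σₙ + 1)²`. -/
theorem flipped_UVt_mem_SO_and_frobSq (n : ℕ) (hn : 1 ≤ n)
    (A U V : Matrix (Fin n) (Fin n) ℝ) (σ : Fin n → ℝ)
    (hA : IsUnit A) (hdet : A.det < 0)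
    (hU : IsOrth U) (hV : IsOrth V)
    (hσdec : Antitone σ) (hσpos : ∀ i, 0 < σ i)
    (hSVD : A = U * Matrix.diagonal σ * Vᵀ) :
    IsSO (U * Matrix.diagonal (fun i : Fin n => if (i : ℕ) = n - 1 then (-1 : ℝ) else 1) * Vᵀ) ∧
    frobNorm (U * Matrix.diagonal (fun i : Fin n => if (i : ℕ) = n - 1 then (-1 : ℝ) else 1) * Vᵀ
        - A) ^ 2
      = (∑ i ∈ Finset.univ.filter (fun i : Fin n => (i : ℕ) < n - 1), (σ i - 1) ^ 2)
        + (σ ⟨n - 1, by omega⟩ + 1) ^ 2 := by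
  set d : Fin n → ℝ := fun i : Fin n => if (i : ℕ) = n - 1 then (-1 : ℝ) else 1 with hd
  have hdd : (fun i => d i * d i) = fun _ => (1 : ℝ) := by
    funext i
    simp only [hd]
    split_ifs <;> norm_num
  have hXX : (U * diagonal d * Vᵀ) * (U * diagonal d * Vᵀ)ᵀ = 1 := by
    rw [conj_mul_transpose hV, hdd, diagonal_one, Matrix.mul_one, hU.2]
  refine ⟨⟨mul_eq_one_comm.mp hXX, hXX, ?_⟩, ?_⟩
  · have hdetd : (diagonal d).det = -1 := by
      rw [det_diagonal, Finset.prod_eq_single (⟨n - 1, by omega⟩ : Fin n)]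
      · simp [hd]
      · intro b _ hb
        have : (b : ℕ) ≠ n - 1 := fun h => hb (Fin.ext h)
        simp [hd, this]
      · simp
    have hprod : 0 < ∏ i, σ i := Finset.prod_pos fun i _ => hσpos i
    have h1 : U.det * U.det = 1 := by
      have := congrArg det hU.1
      simpa using this
    have h2 : V.det * V.det = 1 := by
      have := congrArg det hV.1
      simpa using this
    rw [hSVD, det_mul, det_mul, det_diagonal, det_transpose] at hdet
    rw [det_mul, det_mul, hdetd, det_transpose]
    have h3 : U.det * V.det < 0 := by
      by_contra h
      push Not at h
      nlinarith [mul_nonneg h hprod.le]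
    have h4 : (U.det * V.det) * (U.det * V.det) = 1 := by
      calc _ = (U.det * U.det) * (V.det * V.det) := by ring
        _ = 1 := by rw [h1, h2, one_mul]
    rcases mul_self_eq_one_iff.mp h4 with h | h <;> linarith
  · have hsub : U * diagonal d * Vᵀ - A = U * diagonal (fun i => d i - σ i) * Vᵀ := by
      rw [hSVD, ← Matrix.sub_mul, ← Matrix.mul_sub, diagonal_sub]
    rw [hsub, frobNorm_conj_sq hU hV, sum_split_last (by omega)]
    congr 1
    · refine Finset.sum_congr rfl fun i hi => ?_
      have : (i : ℕ) ≠ n - 1 := (Finset.mem_filter.mp hi).2.ne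
      simp only [hd, if_neg this]
      ring
    · simp only [hd, if_true]
      ring
end
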